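/- Let K be a field of characteristic 2 and V a K-vector space of dimension 2m with symplectic basis x_1,y_1,...,x_m,y_m, and let DV be its divided power algebra with differential ∂ given by multiplication by ω = x_1y_1 + ... + x_my_m. Then for every integer k ≥ 0, the dimension of H^{m+2k}(DV) over K equals 2^m · C(2m + k − 1, k). -/

import Mathlib

noncomputable section

open Finsupp TensorProduct

/-- The underlying space of the divided power algebra `DV` of a vector space `V` with basis
indexed by `ι`: the free `K`-module on the set of multi-indices, where a multi-index
`a : ι →₀ ℕ` corresponds to the basis monomial `∏ᵢ vᵢ^{(a i)}`. -/
abbrev DPA (K ι : Type) [Field K] := (ι →₀ ℕ) →₀ K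

/-- Total degree of a multi-index. -/
def deg {ι : Type} (a : ι →₀ ℕ) : ℕ := a.sum fun _ e => e

/-- The degree-`k` homogeneous component `D_k V` of the divided power algebra. -/
def Dsub (K ι : Type) [Field K] (k : ℕ) : Submodule K (DPA K ι) :=
  Submodule.span K {f | ∃ a : ι →₀ ℕ, deg a = k ∧ f = Finsupp.single a (1 : K)}

/-- The structure constant of the divided power algebra:
`(∏ᵢ vᵢ^{(a i)}) ⬝ (∏ᵢ vᵢ^{(b i)}) = (∏ᵢ C(a i + b i, a i)) • ∏ᵢ vᵢ^{(a i + b i)}`. -/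
def dpCoef {ι : Type} (a b : ι →₀ ℕ) : ℕ :=
  (a + b).prod fun i _ => Nat.choose (a i + b i) (a i)

/-- Multiplication of the divided power algebra, as a bilinear map. -/
def dpMul (K ι : Type) [Field K] : DPA K ι →ₗ[K] DPA K ι →ₗ[K] DPA K ι :=
  Finsupp.lsum K fun a => LinearMap.toSpanSingleton K _
    (Finsupp.lsum K fun b => LinearMap.toSpanSingleton K _
      ((dpCoef a b : K) • Finsupp.single (a + b) (1 : K)))

/-- Divided power `w^{(n)} ∈ D_n V` of a vector `w = ∑ᵢ wᵢ vᵢ ∈ V`; it is determined by the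
rules `(u+v)^{(a)} = ∑ u^{(i)} v^{(a-i)}` and `(t u)^{(a)} = tᵃ u^{(a)}`. -/
def dpow {K ι : Type} [Field K] [Fintype ι] [DecidableEq ι] (w : ι → K) (n : ℕ) : DPA K ι :=
  ∑ c ∈ Finset.univ.finsuppAntidiag n, Finsupp.single c (c.prod fun i e => w i ^ e)

/-- The image `∏ᵢ (g vᵢ)^{(a i)}` of the basis monomial `∏ᵢ vᵢ^{(a i)}` under the algebra
endomorphism of `DV` induced by the matrix `g`. -/
def actMon {K ι : Type} [Field K] [Fintype ι] [DecidableEq ι]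
    (g : Matrix ι ι K) (a : ι →₀ ℕ) : DPA K ι :=
  (a.support.toList.map fun i => dpow (fun j => g j i) (a i)).foldr
    (fun p q => dpMul K ι p q) (Finsupp.single 0 1)

/-- The algebra endomorphism of `DV` induced by the matrix `g` acting on `V` in the given
basis (for `g` invertible this is the induced algebra automorphism of `DV`). -/
def act {K ι : Type} [Field K] [Fintype ι] [DecidableEq ι] (g : Matrix ι ι K) :
    DPA K ι →ₗ[K] DPA K ι :=
  Finsupp.lsum K fun a => LinearMap.toSpanSingleton K _ (actMon g a)

/-- The entrywise square of a matrix (giving the Frobenius twist of a representation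
in characteristic 2). -/
def matSq {K ι : Type} [Field K] (g : Matrix ι ι K) : Matrix ι ι K :=
  fun i j => g i j * g i j

/-! Symplectic setting: `V` has dimension `2m` and symplectic basis `x_1,y_1,…,x_m,y_m`
indexed by `Fin m × Bool`, with `x_i = (i, false)` and `y_i = (i, true)`. -/

/-- The multi-index of the monomial `x_i y_i`. -/
def xyIdx (m : ℕ) (i : Fin m) : (Fin m × Bool) →₀ ℕ :=
  Finsupp.single (i, false) 1 + Finsupp.single (i, true) 1

/-- The element `ω = x_1 y_1 + ⋯ + x_m y_m ∈ D_2 V`. -/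
def omegaDP (K : Type) [Field K] (m : ℕ) : DPA K (Fin m × Bool) :=
  ∑ i : Fin m, Finsupp.single (xyIdx m i) (1 : K)

/-- The differential `∂` of the complex `DV`: multiplication by `ω`.  It restricts to
`∂_k : D_k V → D_{k+2} V`. -/
def del (K : Type) [Field K] (m : ℕ) :
    DPA K (Fin m × Bool) →ₗ[K] DPA K (Fin m × Bool) :=
  dpMul K (Fin m × Bool) (omegaDP K m)

/-- The matrix of the non-degenerate alternating bilinear form `f` with `f(x_i, y_j) = δᵢⱼ`,
`f(x_i, x_j) = f(y_i, y_j) = 0`. -/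
def Jmat (K : Type) [Field K] (m : ℕ) : Matrix (Fin m × Bool) (Fin m × Bool) K :=
  fun p q => if p.1 = q.1 ∧ p.2 ≠ q.2 then 1 else 0

/-- The condition that the matrix `g` belongs to the symplectic group `Sp(V)`:
`g` preserves the form `f`, i.e. `f(gu, gv) = f(u, v)` for all `u, v ∈ V`. -/
def IsSymplectic {K : Type} [Field K] {m : ℕ}
    (g : Matrix (Fin m × Bool) (Fin m × Bool) K) : Prop :=
  g.transpose * Jmat K m * g = Jmat K m

/-- The cocycles in degree `k`: `ker ∂_k = ker ∂ ∩ D_k V`. -/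
def Zmod (K : Type) [Field K] (m k : ℕ) : Submodule K (DPA K (Fin m × Bool)) :=
  LinearMap.ker (del K m) ⊓ Dsub K (Fin m × Bool) k

/-- The coboundaries in degree `k`: `Im ∂_{k-2} = ∂(D_{k-2} V)`.  (For `k = 0, 1`
truncated subtraction gives `∂(D_0 V) ⊆ D_2 V`, which meets `D_k V` only in `0`,
so no harm is done.) -/
def Bful (K : Type) [Field K] (m k : ℕ) : Submodule K (DPA K (Fin m × Bool)) :=
  Submodule.map (del K m) (Dsub K (Fin m × Bool) (k - 2))

/-- The cohomology `H^k(DV) = ker ∂_k / Im ∂_{k-2}` of the complex `DV`, realized as the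
image of `ker ∂_k` in `DV / Im ∂_{k-2}`. -/
abbrev Hcoh (K : Type) [Field K] (m k : ℕ) :=
  ↥(Submodule.map (Bful K m k).mkQ (Zmod K m k))

/-- The canonical projection `ker ∂_k → H^k(DV)`, sending a cocycle `z` to its
cohomology class `z + Im ∂_{k-2}`. -/
def toH (K : Type) [Field K] (m k : ℕ) : ↥(Zmod K m k) →ₗ[K] Hcoh K m k :=
  LinearMap.codRestrict _ ((Bful K m k).mkQ.comp (Zmod K m k).subtype)
    (fun z => Submodule.mem_map_of_mem z.2)


/-! ### Helper material for the proof -/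

/-- `∂_i`: multiplication by `x_i y_i`, in characteristic 2. -/
def dI (K : Type) [Field K] {m : ℕ} (i : Fin m) :
    DPA K (Fin m × Bool) →ₗ[K] DPA K (Fin m × Bool) :=
  Finsupp.linearCombination K fun a =>
    if Even (a (i, false)) ∧ Even (a (i, true)) then Finsupp.single (a + xyIdx m i) (1 : K) else 0

/-- The partial homotopy `h_i`. -/
def hI (K : Type) [Field K] {m : ℕ} (i : Fin m) :
    DPA K (Fin m × Bool) →ₗ[K] DPA K (Fin m × Bool) :=
  Finsupp.linearCombination K fun a =>
    if Odd (a (i, false)) ∧ Odd (a (i, true)) then Finsupp.single (a - xyIdx m i) (1 : K) else 0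

/-- The set of bad indices of a multi-index. -/
def badSet {m : ℕ} (a : (Fin m × Bool) →₀ ℕ) : Finset (Fin m) :=
  Finset.univ.filter fun i => Even (a (i, false) + a (i, true))

open Classical in
/-- The partial homotopy selected by a set of bad indices. -/
def selH (K : Type) [Field K] {m : ℕ} (s : Finset (Fin m)) :
    DPA K (Fin m × Bool) →ₗ[K] DPA K (Fin m × Bool) :=
  if h : s.Nonempty then hI K h.choose else 0

/-- The contracting homotopy. -/
def homot (K : Type) [Field K] (m : ℕ) :
    DPA K (Fin m × Bool) →ₗ[K] DPA K (Fin m × Bool) :=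
  Finsupp.linearCombination K fun a => selH K (badSet a) (Finsupp.single a (1 : K))

/-- The projection on the span of good monomials. -/
def projG (K : Type) [Field K] (m : ℕ) :
    DPA K (Fin m × Bool) →ₗ[K] DPA K (Fin m × Bool) :=
  Finsupp.linearCombination K fun a => if badSet a = ∅ then Finsupp.single a (1 : K) else 0

lemma xyIdx_apply {m : ℕ} (i j : Fin m) (b : Bool) :
    xyIdx m i (j, b) = if i = j then 1 else 0 := by
  cases b <;> simp [xyIdx, Finsupp.single_apply]

lemma dI_single (K : Type) [Field K] {m : ℕ} (i : Fin m) (a : (Fin m × Bool) →₀ ℕ) :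
    dI K i (Finsupp.single a (1 : K)) =
    if Even (a (i, false)) ∧ Even (a (i, true)) then
      Finsupp.single (a + xyIdx m i) (1 : K) else 0 := by
  simp [dI, Finsupp.linearCombination_single]

lemma hI_single (K : Type) [Field K] {m : ℕ} (i : Fin m) (a : (Fin m × Bool) →₀ ℕ) :
    hI K i (Finsupp.single a (1 : K)) =
    if Odd (a (i, false)) ∧ Odd (a (i, true)) then
      Finsupp.single (a - xyIdx m i) (1 : K) else 0 := by
  simp [hI, Finsupp.linearCombination_single]

lemma homot_single (K : Type) [Field K] {m : ℕ} (a : (Fin m × Bool) →₀ ℕ) :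
    homot K m (Finsupp.single a (1 : K)) = selH K (badSet a) (Finsupp.single a (1 : K)) := by
  simp [homot, Finsupp.linearCombination_single]

lemma projG_single (K : Type) [Field K] {m : ℕ} (a : (Fin m × Bool) →₀ ℕ) :
    projG K m (Finsupp.single a (1 : K)) =
      if badSet a = ∅ then Finsupp.single a (1 : K) else 0 := by
  simp [projG, Finsupp.linearCombination_single]

lemma badSet_add {m : ℕ} (a : (Fin m × Bool) →₀ ℕ) (i : Fin m) :
    badSet (a + xyIdx m i) = badSet a := by
  ext j
  simp only [badSet, Finset.mem_filter, Finset.mem_univ, true_and, Finsupp.add_apply, xyIdx_apply]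
  split_ifs <;> grind

lemma dpCoef_xy {m : ℕ} (i : Fin m) (a : (Fin m × Bool) →₀ ℕ) :
    dpCoef (xyIdx m i) a = (a (i, false) + 1) * (a (i, true) + 1) := by
  unfold dpCoef
  rw [Finsupp.prod, Finset.prod_subset (Finset.subset_univ _) (by
    intro p _ hp
    rw [Finsupp.notMem_support_iff, Finsupp.add_apply] at hp
    rw [hp, (Nat.add_eq_zero_iff.1 hp).1, Nat.choose_self])]
  · rw [Fintype.prod_prod_type, Finset.prod_eq_single i]
    · simp [xyIdx_apply, add_comm, mul_comm]
    · intro j _ hj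
      simp [xyIdx_apply, hj.symm]
    · simp

lemma cast_succ_char2 (K : Type) [Field K] [CharP K 2] (n : ℕ) :
    ((n : K) + 1) = if Even n then 1 else 0 := by
  split_ifs with h
  · rw [(CharP.cast_eq_zero_iff K 2 n).2 h.two_dvd, zero_add]
  · have : ((n + 1 : ℕ) : K) = 0 :=
      (CharP.cast_eq_zero_iff K 2 (n + 1)).2 (by rw [Nat.not_even_iff_odd] at h; exact h.add_one.two_dvd)
    exact_mod_cast this

lemma del_single (K : Type) [Field K] [CharP K 2] {m : ℕ} (a : (Fin m × Bool) →₀ ℕ) :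
    del K m (Finsupp.single a (1 : K)) = ∑ i, dI K i (Finsupp.single a (1 : K)) := by
  unfold del omegaDP
  rw [map_sum, LinearMap.sum_apply]
  refine Finset.sum_congr rfl fun i _ => ?_
  rw [dI_single]
  simp only [dpMul, Finsupp.lsum_apply, Finsupp.sum_single_index, map_zero,
    LinearMap.toSpanSingleton_apply, LinearMap.zero_apply, one_smul, dpCoef_xy]
  push_cast
  rw [cast_succ_char2, cast_succ_char2, add_comm (xyIdx m i)]
  by_cases h1 : Even (a (i, false)) <;> by_cases h2 : Even (a (i, true)) <;> simp [h1, h2]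

lemma homot_dI (K : Type) [Field K] {m : ℕ} (i : Fin m) (a : (Fin m × Bool) →₀ ℕ) :
    homot K m (dI K i (Finsupp.single a (1 : K))) =
      selH K (badSet a) (dI K i (Finsupp.single a (1 : K))) := by
  rw [dI_single]
  split_ifs
  · rw [homot_single, badSet_add]
  · simp

lemma add_self_char2 (K : Type) [Field K] [CharP K 2] {m : ℕ} (z : DPA K (Fin m × Bool)) :
    z + z = 0 := by
  have h : (2 : K) = 0 := by exact_mod_cast CharP.cast_eq_zero K 2
  rw [← two_smul K z, h, zero_smul]

lemma dI_hI_comm (K : Type) [Field K] {m : ℕ} (i j : Fin m) (hij : i ≠ j)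
    (a : (Fin m × Bool) →₀ ℕ) :
    dI K j (hI K i (Finsupp.single a (1 : K))) = hI K i (dI K j (Finsupp.single a (1 : K))) := by
  rw [dI_single, hI_single]
  have e : Odd (a (i, false)) ∧ Odd (a (i, true)) →
      a - xyIdx m i + xyIdx m j = a + xyIdx m j - xyIdx m i := by
    rintro ⟨h1, h2⟩
    ext ⟨l, b⟩
    have := h1.pos
    have := h2.pos
    simp only [Finsupp.add_apply, Finsupp.tsub_apply, xyIdx_apply]
    by_cases h : i = l
    · subst h
      simp [hij.symm]
    · simp [h]
  by_cases h1 : Odd (a (i, false)) ∧ Odd (a (i, true)) <;>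
    by_cases h2 : Even (a (j, false)) ∧ Even (a (j, true)) <;>
    simp only [h1, h2, if_true, if_false, map_zero, dI_single, hI_single, Finsupp.add_apply,
      Finsupp.tsub_apply, xyIdx_apply, hij, hij.symm, Nat.sub_zero, Nat.add_zero, and_self]
  rw [e h1]

lemma dI_hI_same (K : Type) [Field K] {m : ℕ} (i : Fin m)
    (a : (Fin m × Bool) →₀ ℕ) (ha : i ∈ badSet a) :
    dI K i (hI K i (Finsupp.single a (1 : K))) + hI K i (dI K i (Finsupp.single a (1 : K)))
      = Finsupp.single a 1 := by
  simp only [badSet, Finset.mem_filter, Finset.mem_univ, true_and] at ha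
  rw [dI_single, hI_single]
  by_cases h : Even (a (i, false))
  · have h' : Even (a (i, true)) := by grind
    have n1 : ¬ Odd (a (i, false)) := by grind
    rw [if_neg (by tauto), if_pos ⟨h, h'⟩, hI_single, map_zero, zero_add, if_pos]
    · simp
    · simp [xyIdx_apply, h.add_one, h'.add_one]
  · have h1 : Odd (a (i, false)) := by grind
    have h2 : Odd (a (i, true)) := by grind
    rw [if_pos ⟨h1, h2⟩, if_neg (by tauto), dI_single, map_zero, add_zero, if_pos]
    · congr 1
      ext ⟨l, b⟩
      have := h1.pos
      have := h2.pos
      simp only [Finsupp.add_apply, Finsupp.tsub_apply, xyIdx_apply]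
      split_ifs with hl
      · subst hl
        cases b <;> omega
      · simp
    · simp only [Finsupp.tsub_apply, xyIdx_apply, if_true]
      grind

lemma main_single (K : Type) [Field K] [CharP K 2] {m : ℕ} (a : (Fin m × Bool) →₀ ℕ) :
    del K m (homot K m (Finsupp.single a (1 : K))) + homot K m (del K m (Finsupp.single a (1 : K)))
      + projG K m (Finsupp.single a (1 : K)) = Finsupp.single a 1 := by
  have del_eq : ∀ z, del K m z = ∑ i, dI K i z := by
    have : del K m = ∑ i, dI K i := by
      refine Finsupp.lhom_ext' fun b => LinearMap.ext_ring ?_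
      simpa using del_single K b
    intro z
    rw [this, LinearMap.sum_apply]
  rw [projG_single, homot_single, del_eq, del_eq, map_sum]
  simp only [homot_dI]
  by_cases h : (badSet a).Nonempty
  · rw [if_neg h.ne_empty, add_zero, ← Finset.sum_add_distrib]
    simp only [selH, dif_pos h]
    rw [Finset.sum_eq_single h.choose]
    · exact dI_hI_same K _ a h.choose_spec
    · intro j _ hj
      rw [dI_hI_comm K _ j hj.symm a, add_self_char2]
    · simp
  · simp only [selH, dif_neg h]
    simp [Finset.not_nonempty_iff_eq_empty.1 h]

lemma main_id (K : Type) [Field K] [CharP K 2] {m : ℕ} (z : DPA K (Fin m × Bool)) :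
    del K m (homot K m z) + homot K m (del K m z) + projG K m z = z := by
  have : del K m ∘ₗ homot K m + homot K m ∘ₗ del K m + projG K m = LinearMap.id := by
    refine Finsupp.lhom_ext' fun b => LinearMap.ext_ring ?_
    simpa using main_single K b
  simpa using LinearMap.congr_fun this z

lemma projG_del (K : Type) [Field K] [CharP K 2] {m : ℕ} (z : DPA K (Fin m × Bool)) :
    projG K m (del K m z) = 0 := by
  have : projG K m ∘ₗ del K m = 0 := by
    refine Finsupp.lhom_ext' fun b => LinearMap.ext_ring ?_
    simp only [LinearMap.comp_apply, Finsupp.lsingle_apply, LinearMap.zero_apply]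
    rw [del_single, map_sum]
    refine Finset.sum_eq_zero fun i _ => ?_
    rw [dI_single]
    split_ifs with h
    · rw [projG_single, badSet_add, if_neg]
      apply Finset.ne_empty_of_mem (a := i)
      simp [badSet, h.1.add h.2]
    · simp
  simpa using LinearMap.congr_fun this z

/-- Good multi-indices of degree `n`. -/
def goodSet (m n : ℕ) : Set ((Fin m × Bool) →₀ ℕ) := {a | badSet a = ∅ ∧ deg a = n}

lemma Dsub_eq (K ι : Type) [Field K] (n : ℕ) :
    Dsub K ι n = Finsupp.supported K K {a : ι →₀ ℕ | deg a = n} := by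
  rw [Finsupp.supported_eq_span_single, Dsub]
  congr 1
  ext f
  simp only [Set.mem_setOf_eq, Set.mem_image]
  constructor
  · rintro ⟨a, h, rfl⟩
    exact ⟨a, h, rfl⟩
  · rintro ⟨a, h, rfl⟩
    exact ⟨a, h, rfl⟩

lemma deg_eq {m : ℕ} (a : (Fin m × Bool) →₀ ℕ) : deg a = ∑ p, a p := by
  rw [deg, Finsupp.sum_fintype _ _ (by simp)]

lemma deg_add {m : ℕ} (a b : (Fin m × Bool) →₀ ℕ) : deg (a + b) = deg a + deg b := by
  simp [deg_eq, Finset.sum_add_distrib]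

lemma deg_xy {m : ℕ} (i : Fin m) : deg (xyIdx m i) = 2 := by
  simp [deg_eq, Fintype.sum_prod_type, xyIdx_apply]

lemma hI_mem (K : Type) [Field K] {m : ℕ} (i : Fin m) (a : (Fin m × Bool) →₀ ℕ) :
    hI K i (Finsupp.single a (1 : K)) ∈ Dsub K (Fin m × Bool) (deg a - 2) := by
  rw [hI_single]
  split_ifs with h
  · apply Submodule.subset_span
    refine ⟨_, ?_, rfl⟩
    have e : a - xyIdx m i + xyIdx m i = a := by
      apply tsub_add_cancel_of_le
      rintro ⟨l, b⟩
      have := h.1.pos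
      have := h.2.pos
      rw [xyIdx_apply]
      split_ifs with hl
      · subst hl
        cases b <;> omega
      · simp
    have := congrArg deg e
    rw [deg_add, deg_xy] at this
    omega
  · exact zero_mem _

lemma homot_mem (K : Type) [Field K] {m n : ℕ} (z : DPA K (Fin m × Bool))
    (hz : z ∈ Dsub K (Fin m × Bool) n) : homot K m z ∈ Dsub K (Fin m × Bool) (n - 2) := by
  have : Dsub K (Fin m × Bool) n ≤ (Dsub K (Fin m × Bool) (n - 2)).comap (homot K m) := by
    rw [Dsub, Submodule.span_le]
    rintro _ ⟨a, rfl, rfl⟩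
    simp only [Submodule.comap_coe, Set.mem_preimage, SetLike.mem_coe]
    rw [homot_single, selH]
    split_ifs with h
    · exact hI_mem K _ a
    · exact zero_mem _
  exact this hz

lemma projG_mem (K : Type) [Field K] {m n : ℕ} (z : DPA K (Fin m × Bool))
    (hz : z ∈ Dsub K (Fin m × Bool) n) : projG K m z ∈ Finsupp.supported K K (goodSet m n) := by
  have : Dsub K (Fin m × Bool) n ≤ (Finsupp.supported K K (goodSet m n)).comap (projG K m) := by
    rw [Dsub, Submodule.span_le]
    rintro _ ⟨a, rfl, rfl⟩
    simp only [Submodule.comap_coe, Set.mem_preimage, SetLike.mem_coe]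
    rw [projG_single]
    split_ifs with h
    · exact Finsupp.single_mem_supported K _ ⟨h, rfl⟩
    · exact zero_mem _
  exact this hz

lemma projG_good (K : Type) [Field K] {m n : ℕ} (z : DPA K (Fin m × Bool))
    (hz : z ∈ Finsupp.supported K K (goodSet m n)) : projG K m z = z := by
  have : Finsupp.supported K K (goodSet m n) ≤ LinearMap.eqLocus (projG K m) LinearMap.id := by
    rw [Finsupp.supported_eq_span_single, Submodule.span_le]
    rintro _ ⟨a, ha, rfl⟩
    simp only [SetLike.mem_coe, LinearMap.mem_eqLocus, LinearMap.id_apply]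
    rw [projG_single, if_pos ha.1]
  exact this hz

lemma good_le (K : Type) [Field K] [CharP K 2] {m n : ℕ} :
    Finsupp.supported K K (goodSet m n) ≤ Zmod K m n := by
  refine le_inf ?_ ?_
  · rw [Finsupp.supported_eq_span_single, Submodule.span_le]
    rintro _ ⟨a, ha, rfl⟩
    simp only [SetLike.mem_coe, LinearMap.mem_ker]
    rw [del_single]
    refine Finset.sum_eq_zero fun i _ => ?_
    rw [dI_single, if_neg]
    rintro ⟨h1, h2⟩
    have : i ∈ badSet a := by simp [badSet, h1.add h2]
    rw [ha.1] at this
    simp at this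
  · rw [Dsub_eq]
    exact Finsupp.supported_mono fun a ha => ha.2

lemma map_eq (K : Type) [Field K] [CharP K 2] (m n : ℕ) :
    Submodule.map (Bful K m n).mkQ (Zmod K m n) =
      Submodule.map (Bful K m n).mkQ (Finsupp.supported K K (goodSet m n)) := by
  apply le_antisymm
  · rintro _ ⟨z, hz, rfl⟩
    refine ⟨projG K m z, projG_mem K z hz.2, ?_⟩
    have h := main_id K z
    have h0 : del K m z = 0 := hz.1
    rw [h0, map_zero, add_zero] at h
    rw [← sub_eq_zero, ← map_sub, Submodule.mkQ_apply, Submodule.Quotient.mk_eq_zero]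
    have : projG K m z - z = - del K m (homot K m z) := by
      rw [sub_eq_iff_eq_add, eq_neg_add_iff_add_eq, h]
    rw [this]
    exact neg_mem (Submodule.mem_map_of_mem (homot_mem K z hz.2))
  · exact Submodule.map_mono (good_le K)

lemma finrank_eq (K : Type) [Field K] [CharP K 2] (m n : ℕ) :
    Module.finrank K (Hcoh K m n) = Nat.card (goodSet m n) := by
  have e : Module.finrank K (Hcoh K m n) = Module.finrank K
      (Submodule.map (Bful K m n).mkQ (Finsupp.supported K K (goodSet m n))) := by
    unfold Hcoh
    rw [map_eq]
  rw [e, ← LinearMap.range_domRestrict, LinearMap.finrank_range_of_inj]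
  · exact Module.finrank_eq_nat_card_basis
      (Module.Basis.ofRepr (Finsupp.supportedEquivFinsupp (goodSet m n)))
  · refine (injective_iff_map_eq_zero _).2 ?_
    rintro ⟨z, hz⟩ h
    rw [LinearMap.domRestrict_apply, Submodule.mkQ_apply, Submodule.Quotient.mk_eq_zero] at h
    obtain ⟨y, _, rfl⟩ := h
    have := projG_good K _ hz
    rw [projG_del] at this
    exact Subtype.ext this.symm

/-- The parametrization of good multi-indices. -/
def goodPar (m k : ℕ)
    (q : (Fin m → Bool) × {P : Fin m × Bool → ℕ // ∑ i, P i = k}) : (Fin m × Bool) →₀ ℕ :=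
  Finsupp.equivFunOnFinite.symm fun p => 2 * q.2.1 p + if q.1 p.1 = p.2 then 1 else 0

lemma goodPar_apply (m k : ℕ) (q) (p) :
    goodPar m k q p = 2 * q.2.1 p + if q.1 p.1 = p.2 then 1 else 0 := rfl

lemma goodPar_inj (m k : ℕ) : Function.Injective (goodPar m k) := by
  rintro ⟨e, c, hc⟩ ⟨e', c', hc'⟩ h
  have h' : ∀ p, 2 * c p + (if e p.1 = p.2 then 1 else 0)
      = 2 * c' p + (if e' p.1 = p.2 then 1 else 0) := fun p => DFunLike.congr_fun h p
  have h1 : e = e' := by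
    funext i
    have := h' (i, e i)
    simp only [if_true] at this
    split_ifs at this with hh
    · exact hh.symm
    · omega
  subst h1
  have h2 : c = c' := by
    funext p
    have := h' p
    omega
  subst h2
  rfl

lemma goodPar_range (m k : ℕ) : Set.range (goodPar m k) = goodSet m (m + 2 * k) := by
  ext a
  constructor
  · rintro ⟨⟨e, c, hc⟩, rfl⟩
    constructor
    · rw [badSet, Finset.filter_eq_empty_iff]
      intro i _
      simp only [goodPar_apply]
      rcases Bool.eq_false_or_eq_true (e i) with h | h <;> simp [h] <;> grind
    · rw [deg_eq]
      simp only [goodPar_apply, Finset.sum_add_distrib, ← Finset.mul_sum, hc]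
      rw [Fintype.sum_prod_type]
      simp [add_comm]
  · rintro ⟨hb, hd⟩
    rw [badSet, Finset.filter_eq_empty_iff] at hb
    have key : ∀ p : Fin m × Bool, a p = 2 * (a p / 2) +
        if decide (Odd (a (p.1, true))) = p.2 then 1 else 0 := by
      rintro ⟨i, b⟩
      have := hb (Finset.mem_univ i)
      cases b <;> simp <;> split_ifs <;> grind
    have hs : ∑ p, a p / 2 = k := by
      rw [deg_eq, Finset.sum_congr rfl fun p _ => key p, Finset.sum_add_distrib, ← Finset.mul_sum] at hd
      have : (∑ p : Fin m × Bool, if decide (Odd (a (p.1, true))) = p.2 then 1 else 0) = m := by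
        rw [Fintype.sum_prod_type]
        have h1 : ∀ c : Bool, (∑ b : Bool, if c = b then 1 else 0) = 1 := by decide
        rw [Finset.sum_congr rfl fun i _ => h1 (decide (Odd (a (i, true))))]
        simp
      omega
    refine ⟨⟨fun i => decide (Odd (a (i, true))), fun p => a p / 2, hs⟩, ?_⟩
    ext p
    rw [goodPar_apply]
    exact (key p).symm

lemma card_good (m k : ℕ) :
    Nat.card (goodSet m (m + 2 * k)) = 2 ^ m * Nat.choose (2 * m + k - 1) k := by
  rw [← goodPar_range, Nat.card_congr (Equiv.ofInjective _ (goodPar_inj m k)).symm, Nat.card_prod,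
    Nat.card_congr (Sym.equivNatSumOfFintype (Fin m × Bool) k).symm, Nat.card_eq_fintype_card,
    Nat.card_eq_fintype_card, Sym.card_sym_eq_choose]
  simp [mul_comm m 2]

/-- For `k ≥ 0`, `dim H^{m+2k}(DV) = 2^m ⬝ C(2m + k - 1, k)`. -/
theorem statement_7 (K : Type) [Field K] [CharP K 2] (m k : ℕ) (hm : 1 ≤ m) :
    Module.finrank K (Hcoh K m (m + 2 * k)) = 2 ^ m * Nat.choose (2 * m + k - 1) k := by
  rw [finrank_eq, card_good]
end
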